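/- Let n ≥ 3, γ > 0 and α ∈ [0, π/2), and let A be an invertible n×n complex matrix. If det(I + A·B) ≠ 0 for every matrix B ∈ S_γ(α), then there exist nonnegative real numbers k₁, k₂, k₃, k₄ such that the Hermitian matrix k₁·(I − γ²·A*A) + k₂·H(e^{−i(π/2−α)}·A) + k₃·H(e^{i(π/2−α)}·A) + k₄·(γ·sec(α)·H(A) + I) is positive definite. -/

import Mathlib

open Matrix
open scoped ComplexOrder

noncomputable section

/-- Hermitian part of a complex matrix: `H(A) = (A + A*) / 2`. -/
def Hpart {n : ℕ} (A : Matrix (Fin n) (Fin n) ℂ) : Matrix (Fin n) (Fin n) ℂ :=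
  (2⁻¹ : ℂ) • (A + Aᴴ)

/-- Membership in the symmetric sectored-disk set `S_γ(α)`. -/
def memSD {n : ℕ} (γ α : ℝ) (B : Matrix (Fin n) (Fin n) ℂ) : Prop :=
  (((γ ^ 2 : ℝ) : ℂ) • (1 : Matrix (Fin n) (Fin n) ℂ) - Bᴴ * B).PosSemidef ∧
  (Hpart (Complex.exp (-Complex.I * ((Real.pi / 2 - α : ℝ) : ℂ)) • B)).PosSemidef ∧
  (Hpart (Complex.exp (Complex.I * ((Real.pi / 2 - α : ℝ) : ℂ)) • B)).PosSemidef

open scoped ComplexConjugate InnerProductSpace Pointwise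

theorem exists_mul_conj_eq {m₁ m₂ : ℝ} {ζ : ℂ} (h₁ : 0 ≤ m₁) (h₂ : 0 ≤ m₂)
    (h : m₁ * m₂ = ‖ζ‖ ^ 2) :
    ∃ c d : ℂ, ‖c‖ ^ 2 = m₁ ∧ ‖d‖ ^ 2 = m₂ ∧ conj c * d = ζ := by
  rcases h₁.eq_or_lt with rfl | h₁
  · have hζ : ζ = 0 := by simpa using h.symm
    exact ⟨0, (√m₂ : ℝ), by simp, by simp [Real.sq_sqrt h₂], by simp [hζ]⟩
  · have hs : √m₁ ≠ 0 := (Real.sqrt_pos.2 h₁).ne'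
    refine ⟨(√m₁ : ℝ), ζ / (√m₁ : ℝ), by simp [Real.sq_sqrt h₁.le], ?_, ?_⟩
    · rw [norm_div, div_pow, ← h]
      simp only [Complex.norm_real, Real.norm_eq_abs, sq_abs, Real.sq_sqrt h₁.le]
      field_simp
    · rw [Complex.conj_ofReal]
      field_simp

section NumericalRange

variable {E : Type*} [NormedAddCommGroup E] [InnerProductSpace ℂ E]

theorem norm_smul_add_smul_sq (c d : ℂ) (x y : E) :
    ‖c • x + d • y‖ ^ 2 =
      ‖c‖ ^ 2 * ‖x‖ ^ 2 + ‖d‖ ^ 2 * ‖y‖ ^ 2 + 2 * (conj c * d * ⟪x, y⟫_ℂ).re := by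
  rw [norm_add_sq (𝕜 := ℂ), norm_smul, norm_smul, inner_smul_left, inner_smul_right]
  simp only [RCLike.re_eq_complex_re, mul_assoc]
  ring

theorem inner_map_smul_add_smul (T : E →ₗ[ℂ] E) (c d : ℂ) (x y : E) :
    ⟪c • x + d • y, T (c • x + d • y)⟫_ℂ =
      (‖c‖ ^ 2 : ℝ) * ⟪x, T x⟫_ℂ + (‖d‖ ^ 2 : ℝ) * ⟪y, T y⟫_ℂ
        + (conj c * d * ⟪x, T y⟫_ℂ + conj (conj c * d) * ⟪y, T x⟫_ℂ) := by
  simp only [map_add, map_smul, inner_add_left, inner_add_right, inner_smul_left,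
    inner_smul_right, map_mul, Complex.conj_conj, Complex.ofReal_pow, ← Complex.conj_mul']
  ring

/-- A positive semidefinite `2 × 2` coefficient matrix with a nonpositive value on the Gram matrix
of two independent unit vectors vanishes. -/
theorem eq_zero_of_gram_nonpos {g ζ : ℂ} {m₁ m₂ : ℝ} (hg : ‖g‖ < 1) (hm : 0 ≤ m₁ + m₂)
    (hζ : ‖ζ‖ ^ 2 ≤ m₁ * m₂) (h : m₁ + m₂ + 2 * (ζ * g).re ≤ 0) :
    m₁ = 0 ∧ m₂ = 0 ∧ ζ = 0 := by
  have h1 : -(‖ζ‖ * ‖g‖) ≤ (ζ * g).re := by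
    rw [← norm_mul]
    exact (abs_le.1 (Complex.abs_re_le_norm _)).1
  have h2 : 2 * ‖ζ‖ ≤ m₁ + m₂ := abs_le_of_sq_le_sq' (by nlinarith [sq_nonneg (m₁ - m₂)]) hm |>.2
  have h3 : m₁ + m₂ = 0 := by nlinarith [norm_nonneg ζ, norm_nonneg g]
  have h4 : m₂ = -m₁ := by linarith
  subst h4
  have h5 : m₁ = 0 := by nlinarith [sq_nonneg ‖ζ‖, sq_nonneg m₁]
  subst h5
  refine ⟨rfl, by simp, ?_⟩
  rw [← norm_eq_zero]
  nlinarith [norm_nonneg ζ]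

/-- The upper part of the Davis–Wielandt shell is convex in every dimension. -/
theorem exists_unit_inner_eq_norm_ge (T : E →ₗ[ℂ] E) {x y : E} (hx : ‖x‖ = 1) (hy : ‖y‖ = 1)
    {s t : ℝ} (hs : 0 ≤ s) (ht : 0 ≤ t) (hst : s + t = 1) :
    ∃ z : E, ‖z‖ = 1 ∧ ⟪z, T z⟫_ℂ = s * ⟪x, T x⟫_ℂ + t * ⟪y, T y⟫_ℂ ∧
      s * ‖T x‖ ^ 2 + t * ‖T y‖ ^ 2 ≤ ‖T z‖ ^ 2 := by
  have hle : ‖⟪x, y⟫_ℂ‖ ≤ 1 := by simpa [hx, hy] using norm_inner_le_norm (𝕜 := ℂ) x y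
  rcases hle.eq_or_lt with hg | hg
  · obtain ⟨r, -, rfl⟩ := (norm_inner_eq_norm_iff (𝕜 := ℂ) (x := x) (y := y)
      (by rw [← norm_ne_zero_iff]; simp [hx]) (by rw [← norm_ne_zero_iff]; simp [hy])).1
      (by rw [hg, hx, hy, mul_one])
    have hr : ‖r‖ = 1 := by simpa [norm_smul, hx] using hy
    refine ⟨x, hx, ?_, ?_⟩
    · rw [map_smul, inner_smul_left, inner_smul_right, ← mul_assoc (conj r), Complex.conj_mul', hr]
      have : (s : ℂ) + t = 1 := by exact_mod_cast hst
      push_cast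
      linear_combination -⟪x, T x⟫_ℂ * this
    · rw [map_smul, norm_smul, hr, one_mul, ← add_mul, hst, one_mul]
  let Φ : (ℝ × ℝ × ℂ) →ₗ[ℝ] (ℝ × ℂ) :=
    { toFun := fun m => (m.1 + m.2.1 + 2 * (m.2.2 * ⟪x, y⟫_ℂ).re,
        m.1 * ⟪x, T x⟫_ℂ + m.2.1 * ⟪y, T y⟫_ℂ
          + (m.2.2 * ⟪x, T y⟫_ℂ + conj m.2.2 * ⟪y, T x⟫_ℂ))
      map_add' := by
        intro m m'
        ext1
        · simp; ring
        · simp; ring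
      map_smul' := by
        intro r m
        ext1
        · simp; ring
        · simp; ring }
  have hker : LinearMap.ker Φ ≠ ⊥ := LinearMap.ker_ne_bot_of_finrank_lt (by simp)
  obtain ⟨⟨α, β, ζ⟩, hZ, hZ0⟩ := Submodule.exists_mem_ne_zero_of_ne_bot hker
  let q : ℝ × ℝ × ℂ → ℝ := fun m =>
    m.1 * ‖T x‖ ^ 2 + m.2.1 * ‖T y‖ ^ 2 + 2 * (m.2.2 * ⟪T x, T y⟫_ℂ).re
  wlog hq : 0 ≤ q (α, β, ζ) generalizing α β ζ
  · refine this (-α) (-β) (-ζ) (by simpa using neg_mem hZ) ?_ ?_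
    · intro h0
      apply hZ0
      simpa using h0
    · simp only [q] at hq ⊢
      push Not at hq
      simp only [neg_mul, Complex.neg_re]
      linarith
  have hΦ : Φ (α, β, ζ) = 0 := hZ
  obtain ⟨hI, ha⟩ := Prod.ext_iff.1 hΦ
  simp only [Φ, LinearMap.coe_mk, AddHom.coe_mk, Prod.fst_zero, Prod.snd_zero] at hI ha
  have hdet : α * β < ‖ζ‖ ^ 2 := by
    by_contra! hcon
    apply hZ0
    rcases le_total 0 (α + β) with hab | hab
    · obtain ⟨rfl, rfl, rfl⟩ := eq_zero_of_gram_nonpos hg hab hcon hI.le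
      rfl
    · have := eq_zero_of_gram_nonpos (g := ⟪x, y⟫_ℂ) (ζ := -ζ) (m₁ := -α) (m₂ := -β) hg
        (by linarith) (by simpa using hcon) (by rw [neg_mul, Complex.neg_re]; linarith)
      simpa using this
  obtain ⟨τ, hτ0, hτ⟩ : ∃ τ : ℝ, 0 ≤ τ ∧ (s + τ * α) * (t + τ * β) = ‖(τ : ℂ) * ζ‖ ^ 2 := by
    set D := ‖ζ‖ ^ 2 - α * β with hD
    have hDpos : 0 < D := by linarith
    set b := s * β + t * α
    have hroot : 0 ≤ b ^ 2 + 4 * D * (s * t) := by positivity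
    refine ⟨(b + √(b ^ 2 + 4 * D * (s * t))) / (2 * D), ?_, ?_⟩
    · have : |b| ≤ √(b ^ 2 + 4 * D * (s * t)) :=
        Real.abs_le_sqrt (by nlinarith [mul_nonneg hDpos.le (mul_nonneg hs ht)])
      have := (abs_le.1 this).1
      apply div_nonneg <;> linarith
    · set τ := (b + √(b ^ 2 + 4 * D * (s * t))) / (2 * D) with hτ
      have h1 : 2 * D * τ - b = √(b ^ 2 + 4 * D * (s * t)) := by rw [hτ]; field_simp; ring
      have h2 := Real.sq_sqrt hroot
      rw [← h1] at h2
      have h3 : D * τ ^ 2 - b * τ - s * t = 0 := by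
        have : 4 * D * (D * τ ^ 2 - b * τ - s * t) = 0 := by linarith
        simpa [hDpos.ne'] using this
      rw [norm_mul, mul_pow, Complex.norm_real, Real.norm_eq_abs, sq_abs]
      simp only [hD, b] at h3
      linarith
  have hsum : (s + τ * α) + (t + τ * β) + 2 * ((τ * ζ) * ⟪x, y⟫_ℂ).re = 1 := by
    rw [mul_assoc, Complex.re_ofReal_mul]
    linear_combination hst + τ * hI
  have hnn : 0 ≤ s + τ * α ∧ 0 ≤ t + τ * β := by
    have hprod : 0 ≤ (s + τ * α) * (t + τ * β) := hτ ▸ sq_nonneg _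
    rcases mul_nonneg_iff.1 hprod with h' | h'
    · exact h'
    · have := eq_zero_of_gram_nonpos (g := ⟪x, y⟫_ℂ) (ζ := -(τ * ζ)) (m₁ := -(s + τ * α))
        (m₂ := -(t + τ * β)) hg (by linarith) (by rw [norm_neg]; linarith)
        (by rw [neg_mul, Complex.neg_re]; linarith)
      exact ⟨by linarith [this.1], by linarith [this.2.1]⟩
  obtain ⟨c, d, hc, hd, hcd⟩ := exists_mul_conj_eq hnn.1 hnn.2 hτ
  refine ⟨c • x + d • y, ?_, ?_, ?_⟩
  · have := norm_smul_add_smul_sq c d x y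
    rw [hc, hd, hcd, hx, hy, one_pow, mul_one, mul_one, hsum] at this
    exact (pow_eq_one_iff_of_nonneg (norm_nonneg _) two_ne_zero).1 this
  · rw [inner_map_smul_add_smul, hc, hd, hcd]
    push_cast
    rw [map_mul, Complex.conj_ofReal]
    linear_combination (τ : ℂ) * ha
  · rw [map_add, map_smul, map_smul, norm_smul_add_smul_sq, hc, hd, hcd, mul_assoc (τ : ℂ),
      Complex.re_ofReal_mul]
    simp only [q] at hq
    nlinarith [mul_nonneg hτ0 hq]

end NumericalRange

/-- The closed disk of radius `γ` intersected with the closed sector of half-angle `α`. -/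
def sectorDisk (γ α : ℝ) : Set ℂ :=
  {z | ‖z‖ ≤ γ ∧ 0 ≤ Real.sin α * z.re + Real.cos α * z.im ∧
    0 ≤ Real.sin α * z.re - Real.cos α * z.im}

/-- The graph of the squared modulus over the sectored disk. -/
def sectorParaboloid (γ α : ℝ) : Set (ℂ × ℝ) :=
  (fun z : ℂ => (z, ‖z‖ ^ 2)) '' sectorDisk γ α

section Hull

variable {γ α : ℝ}

theorem mk_sq_mem_convexHull_of_chord {b : ℂ} (hγ : 0 < γ) (hc : 0 < Real.cos α)
    (hs : 0 ≤ Real.sin α) (hb : ‖b‖ ≤ γ) (hre : γ * Real.cos α ≤ b.re) :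
    (b, γ ^ 2) ∈ convexHull ℝ (sectorParaboloid γ α) := by
  have hbsq : b.re ^ 2 + b.im ^ 2 ≤ γ ^ 2 := by
    have h1 : ‖b‖ ^ 2 ≤ γ ^ 2 := by gcongr
    rwa [Complex.sq_norm, Complex.normSq_apply, ← sq, ← sq] at h1
  have hr : 0 < b.re := lt_of_lt_of_le (by positivity) hre
  set y := √(γ ^ 2 - b.re ^ 2) with hy
  have hy0 : 0 ≤ y := Real.sqrt_nonneg _
  have hysq : y ^ 2 = γ ^ 2 - b.re ^ 2 := Real.sq_sqrt (by nlinarith [sq_nonneg b.im])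
  have hcy : Real.cos α * y ≤ Real.sin α * b.re := by
    apply abs_le_of_sq_le_sq' _ (by positivity) |>.2
    rw [mul_pow, mul_pow, hysq, Real.sin_sq]
    have : (γ * Real.cos α) ^ 2 ≤ b.re ^ 2 := by gcongr
    linarith
  have hend : ∀ w : ℝ, w ^ 2 = y ^ 2 → |w| ≤ y →
      ((⟨b.re, w⟩ : ℂ), γ ^ 2) ∈ sectorParaboloid γ α := by
    intro w hw hwy
    have hn : ‖(⟨b.re, w⟩ : ℂ)‖ ^ 2 = γ ^ 2 := by
      rw [Complex.sq_norm, Complex.normSq_apply]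
      linarith
    obtain ⟨h1, h2⟩ := abs_le.1 hwy
    refine ⟨⟨b.re, w⟩, ⟨?_, ?_, ?_⟩, by simp only [hn]⟩
    · exact (abs_le_of_sq_le_sq' hn.le hγ.le).2
    · change 0 ≤ Real.sin α * b.re + Real.cos α * w
      nlinarith
    · change 0 ≤ Real.sin α * b.re - Real.cos α * w
      nlinarith
  have hp := hend y rfl (abs_of_nonneg hy0).le
  have hm := hend (-y) (by ring) (by rw [abs_neg, abs_of_nonneg hy0])
  obtain ⟨hb1, hb2⟩ : -y ≤ b.im ∧ b.im ≤ y := abs_le.1 (Real.abs_le_sqrt (by linarith))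
  refine (convex_convexHull ℝ _).segment_subset (subset_convexHull ℝ _ hm)
    (subset_convexHull ℝ _ hp) ?_
  rcases hy0.eq_or_lt with h0 | h0
  · have him : b.im = y := by linarith
    have : b = ⟨b.re, y⟩ := Complex.ext rfl him
    rw [← this]
    exact right_mem_segment ℝ _ _
  · refine ⟨(y - b.im) / (2 * y), (y + b.im) / (2 * y), div_nonneg (by linarith) (by linarith),
      div_nonneg (by linarith) (by linarith), by field_simp; ring, ?_⟩
    ext1
    · apply Complex.ext
      · simp only [Prod.smul_mk, Prod.mk_add_mk, Complex.add_re, Complex.smul_re, smul_eq_mul]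
        field_simp
        ring
      · simp only [Prod.smul_mk, Prod.mk_add_mk, Complex.add_im, Complex.smul_im, smul_eq_mul]
        field_simp
        ring
    · simp only [Prod.smul_mk, Prod.mk_add_mk, smul_eq_mul]
      field_simp
      ring

theorem mk_mem_convexHull_sectorParaboloid {b : ℂ} {ρ : ℝ} (hγ : 0 < γ) (hc : 0 < Real.cos α)
    (hs : 0 ≤ Real.sin α) (h1 : 0 ≤ Real.sin α * b.re + Real.cos α * b.im)
    (h2 : 0 ≤ Real.sin α * b.re - Real.cos α * b.im) (hbρ : ‖b‖ ^ 2 ≤ ρ) (hργ : ρ ≤ γ ^ 2)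
    (hre : ρ * Real.cos α ≤ γ * b.re) :
    (b, ρ) ∈ convexHull ℝ (sectorParaboloid γ α) := by
  have hbγ : ‖b‖ ≤ γ := (abs_le_of_sq_le_sq' (hbρ.trans hργ) hγ.le).2
  have hb : (b, ‖b‖ ^ 2) ∈ convexHull ℝ (sectorParaboloid γ α) :=
    subset_convexHull ℝ _ ⟨b, ⟨hbγ, h1, h2⟩, rfl⟩
  obtain ⟨M, hM, hρM⟩ : ∃ M, (b, M) ∈ convexHull ℝ (sectorParaboloid γ α) ∧ ρ ≤ M := by
    rcases le_total (γ * Real.cos α) b.re with hr | hr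
    · exact ⟨γ ^ 2, mk_sq_mem_convexHull_of_chord hγ hc hs hbγ hr, hργ⟩
    have hρ0 : 0 ≤ ρ := (sq_nonneg _).trans hbρ
    have hr0 : 0 ≤ b.re := by
      by_contra! hneg
      nlinarith [mul_nonneg hρ0 hc.le]
    rcases hr0.eq_or_lt with h0 | h0
    · refine ⟨‖b‖ ^ 2, hb, ?_⟩
      rw [← h0, mul_zero] at hre
      nlinarith [sq_nonneg ‖b‖]
    · set w := b.re / (γ * Real.cos α) with hw
      have hw0 : 0 < w := by positivity
      have hw1 : w ≤ 1 := (div_le_one (by positivity)).2 hr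
      have hwr : b.re = w * (γ * Real.cos α) := by rw [hw]; field_simp
      set e : ℂ := ⟨γ * Real.cos α, b.im / w⟩ with he
      have hbe : b = w • e := by
        apply Complex.ext
        · simp [he, hwr]
        · simp [he]
          field_simp
      have him : (b.im / w) ^ 2 ≤ (γ * Real.sin α) ^ 2 := by
        apply sq_le_sq'
        · rw [le_div_iff₀ hw0]
          nlinarith
        · rw [div_le_iff₀ hw0]
          nlinarith
      have hen : ‖e‖ ≤ γ := by
        refine (abs_le_of_sq_le_sq' ?_ hγ.le).2
        rw [Complex.sq_norm, Complex.normSq_apply]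
        simp only [he]
        nlinarith [Real.sin_sq_add_cos_sq α]
      have hE := mk_sq_mem_convexHull_of_chord (b := e) hγ hc hs hen le_rfl
      have hO : ((0 : ℂ), (0 : ℝ)) ∈ convexHull ℝ (sectorParaboloid γ α) :=
        subset_convexHull ℝ _ ⟨0, ⟨by simpa using hγ.le, by simp, by simp⟩, by simp⟩
      refine ⟨w * γ ^ 2, ?_, ?_⟩
      · have := (convex_convexHull ℝ _) hE hO hw0.le (sub_nonneg.2 hw1) (by ring)
        simpa [← hbe] using this
      · rw [hwr] at hre
        have : ρ * Real.cos α ≤ (w * γ ^ 2) * Real.cos α := by linarith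
        exact le_of_mul_le_mul_right this hc
  refine (convex_convexHull ℝ _).segment_subset hb hM ?_
  rw [← Prod.image_mk_segment_right]
  exact ⟨ρ, by rw [segment_eq_Icc (hbρ.trans hρM)]; exact ⟨hbρ, hρM⟩, rfl⟩

end Hull

section Interpolation

variable {E : Type*} [NormedAddCommGroup E] [InnerProductSpace ℂ E]

theorem sum_weights_quadratic {ι : Type*} {S : Finset ι} {w : ι → ℝ} {l : ι → ℂ} {b : ℂ} {ρ : ℝ}
    (hw1 : ∑ i ∈ S, w i = 1) (hb : ∑ i ∈ S, (w i : ℂ) * l i = b)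
    (hρ : ∑ i ∈ S, w i * ‖l i‖ ^ 2 = ρ) (k₁ k₂ k₃ k₄ : ℂ) :
    ∑ i ∈ S, (w i : ℂ) * (k₁ + k₂ * l i + k₃ * conj (l i) + k₄ * (l i * conj (l i))) =
      k₁ + k₂ * b + k₃ * conj b + k₄ * ρ := by
  have h1 : ∑ i ∈ S, (w i : ℂ) = 1 := by exact_mod_cast hw1
  have h2 : ∑ i ∈ S, (w i : ℂ) * conj (l i) = conj b := by simp [← hb]
  have h3 : ∑ i ∈ S, (w i : ℂ) * (l i * conj (l i)) = ρ := by
    simp [← hρ, Complex.mul_conj']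
  rw [← h2, ← hb, ← h3]
  nth_rw 2 [← mul_one k₁]
  rw [← h1]
  simp only [Finset.mul_sum, ← Finset.sum_add_distrib]
  exact Finset.sum_congr rfl fun i _ => by ring

theorem exists_linearMap_of_weights {ι : Type*} (S : Finset ι) (w : ι → ℝ) (l : ι → ℂ) {γ : ℝ}
    (hγ : 0 ≤ γ) (hw : ∀ i ∈ S, 0 ≤ w i) (hw1 : ∑ i ∈ S, w i = 1) (hl : ∀ i ∈ S, ‖l i‖ ≤ γ)
    {u v : E} (hu : ‖u‖ = 1) (hb : ∑ i ∈ S, (w i : ℂ) * l i = ⟪u, v⟫_ℂ)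
    (hρ : ∑ i ∈ S, w i * ‖l i‖ ^ 2 = ‖v‖ ^ 2) :
    ∃ L : E →ₗ[ℂ] E, L u = v ∧ (∀ z, ‖L z‖ ≤ γ * ‖z‖) ∧
      ∀ z, ∃ r : ι → ℝ, (∀ i ∈ S, 0 ≤ r i) ∧ ⟪z, L z⟫_ℂ = ∑ i ∈ S, (r i : ℂ) * l i := by
  set b := ⟪u, v⟫_ℂ with hbdef
  have hbγ : ‖b‖ ≤ γ := by
    rw [← hb]
    calc ‖∑ i ∈ S, (w i : ℂ) * l i‖ ≤ ∑ i ∈ S, w i * γ := by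
          refine norm_sum_le_of_le S fun i hi => ?_
          rw [norm_mul, Complex.norm_real, Real.norm_of_nonneg (hw i hi)]
          exact mul_le_mul_of_nonneg_left (hl i hi) (hw i hi)
      _ = γ := by rw [← Finset.sum_mul, hw1, one_mul]
  have huu : ⟪u, u⟫_ℂ = 1 := by simp [inner_self_eq_norm_sq_to_K, hu]
  obtain ⟨d, hd⟩ : ∃ d, d = v - b • u := ⟨_, rfl⟩
  have hv : v = b • u + d := by rw [hd]; abel
  have hud : ⟪u, d⟫_ℂ = 0 := by rw [hd, inner_sub_right, inner_smul_right, huu, ← hbdef]; ring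
  have hdu : ⟪d, u⟫_ℂ = 0 := inner_eq_zero_symm.1 hud
  rcases eq_or_ne d 0 with rfl | hd0
  · rw [add_zero] at hv
    refine ⟨b • LinearMap.id, by simp [hv], fun z => ?_,
      fun z => ⟨fun i => w i * ‖z‖ ^ 2, fun i hi => mul_nonneg (hw i hi) (sq_nonneg _), ?_⟩⟩
    · simpa [norm_smul] using mul_le_mul_of_nonneg_right hbγ (norm_nonneg z)
    · simp only [LinearMap.smul_apply, LinearMap.id_apply, inner_smul_right,
        inner_self_eq_norm_sq_to_K, ← hb, Finset.sum_mul]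
      refine Finset.sum_congr rfl fun i _ => ?_
      push_cast
      simp only [Complex.coe_algebraMap]
      ring
  set D : ℝ := ‖d‖ ^ 2 with hD
  have hDpos : 0 < D := by positivity
  have hDC : (D : ℂ) ≠ 0 := by exact_mod_cast hDpos.ne'
  have hdd : ⟪d, d⟫_ℂ = D := by simp [inner_self_eq_norm_sq_to_K, hD]
  have hvD : ((‖v‖ ^ 2 : ℝ) : ℂ) = b * conj b + D := by
    have : ⟪v, v⟫_ℂ = ((‖v‖ ^ 2 : ℝ) : ℂ) := by simp [inner_self_eq_norm_sq_to_K]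
    rw [← this, hv]
    simp only [inner_add_left, inner_add_right, inner_smul_left, inner_smul_right, huu, hud, hdu,
      hdd]
    ring
  have hquad := sum_weights_quadratic hw1 hb hρ
  let W : ι → E := fun i => u + conj ((l i - b) / D) • d
  have hW : ∀ i z, ⟪W i, z⟫_ℂ = ⟪u, z⟫_ℂ + (l i - b) / D * ⟪d, z⟫_ℂ := by
    intro i z
    simp only [W, inner_add_left, inner_smul_left, Complex.conj_conj]
  have hBessel : ∀ z, ∑ i ∈ S, w i * ‖⟪W i, z⟫_ℂ‖ ^ 2 ≤ ‖z‖ ^ 2 := by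
    intro z
    have h1 : ∑ i ∈ S, w i * ‖⟪W i, z⟫_ℂ‖ ^ 2 = ‖⟪u, z⟫_ℂ‖ ^ 2 + ‖⟪d, z⟫_ℂ‖ ^ 2 / D := by
      have h2 := hquad
        ((⟪u, z⟫_ℂ - b / D * ⟪d, z⟫_ℂ) * conj (⟪u, z⟫_ℂ - b / D * ⟪d, z⟫_ℂ))
        (conj (⟪u, z⟫_ℂ - b / D * ⟪d, z⟫_ℂ) * (⟪d, z⟫_ℂ / D))
        ((⟪u, z⟫_ℂ - b / D * ⟪d, z⟫_ℂ) * conj (⟪d, z⟫_ℂ / D))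
        (⟪d, z⟫_ℂ / D * conj (⟪d, z⟫_ℂ / D))
      apply Complex.ofReal_injective
      push_cast
      simp only [hW, ← Complex.mul_conj']
      refine Eq.trans (Finset.sum_congr rfl fun i _ => ?_) (h2.trans ?_)
      · simp only [map_add, map_sub, map_mul, map_div₀, Complex.conj_ofReal]
        ring
      · rw [hvD]
        simp only [map_sub, map_mul, map_div₀, Complex.conj_ofReal]
        field_simp
        ring
    have h3 : ‖z - (⟪u, z⟫_ℂ • u + (⟪d, z⟫_ℂ / D) • d)‖ ^ 2
        = ‖z‖ ^ 2 - (‖⟪u, z⟫_ℂ‖ ^ 2 + ‖⟪d, z⟫_ℂ‖ ^ 2 / D) := by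
      apply Complex.ofReal_injective
      push_cast
      have hn : ∀ x : E, (‖x‖ : ℂ) ^ 2 = ⟪x, x⟫_ℂ := fun x => by
        simp [inner_self_eq_norm_sq_to_K]
      simp only [← Complex.mul_conj', hn, inner_sub_left, inner_sub_right, inner_add_left,
        inner_add_right, inner_smul_left, inner_smul_right, huu, hud, hdu, hdd, map_div₀,
        Complex.conj_ofReal, inner_conj_symm]
      field_simp
      ring
    have := sq_nonneg ‖z - (⟪u, z⟫_ℂ • u + (⟪d, z⟫_ℂ / D) • d)‖
    linarith
  let L : E →ₗ[ℂ] E := ∑ i ∈ S, ((w i : ℂ) * l i) • (innerₛₗ ℂ (W i)).smulRight (W i)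
  have hL : ∀ z, L z = ∑ i ∈ S, ((w i : ℂ) * l i) • ⟪W i, z⟫_ℂ • W i := by
    intro z
    simp [L, LinearMap.sum_apply]
  refine ⟨L, ?_, fun z => ?_, fun z => ⟨fun i => w i * ‖⟪W i, z⟫_ℂ‖ ^ 2,
    fun i hi => mul_nonneg (hw i hi) (sq_nonneg _), ?_⟩⟩
  · have h2 := hquad 0 (-conj b / D) 0 (1 / D)
    rw [hL, hv]
    simp only [hW, huu, hdu, mul_zero, add_zero, one_smul, W, smul_add, Finset.sum_add_distrib,
      smul_smul, ← Finset.sum_smul, hb]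
    congr 1
    refine Eq.trans (congrArg (· • d) (Eq.trans (Finset.sum_congr rfl fun i _ => ?_)
      (h2.trans ?_))) (one_smul ℂ d)
    · simp only [map_sub, map_div₀, Complex.conj_ofReal]
      ring
    · rw [hvD]
      field_simp
      ring
  · have h1 : ‖L z‖ ^ 2 ≤ ∑ i ∈ S,
        (γ ^ 2 * (w i * ‖⟪W i, z⟫_ℂ‖ ^ 2) + w i * ‖⟪W i, L z⟫_ℂ‖ ^ 2) / 2 := by
      have h2 : ‖L z‖ ^ 2 = ‖⟪L z, L z⟫_ℂ‖ := by
        simp [inner_self_eq_norm_sq_to_K]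
      rw [h2]
      nth_rw 2 [hL z]
      rw [inner_sum]
      refine norm_sum_le_of_le S fun i hi => ?_
      rw [inner_smul_right, inner_smul_right, norm_mul, norm_mul, norm_mul, Complex.norm_real,
        Real.norm_of_nonneg (hw i hi), norm_inner_symm (L z)]
      have h3 : ‖l i‖ * (‖⟪W i, z⟫_ℂ‖ * ‖⟪W i, L z⟫_ℂ‖) ≤
          γ * (‖⟪W i, z⟫_ℂ‖ * ‖⟪W i, L z⟫_ℂ‖) :=
        mul_le_mul_of_nonneg_right (hl i hi) (by positivity)
      nlinarith [mul_le_mul_of_nonneg_left h3 (hw i hi),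
        mul_nonneg (hw i hi) (sq_nonneg (γ * ‖⟪W i, z⟫_ℂ‖ - ‖⟪W i, L z⟫_ℂ‖))]
    rw [← Finset.sum_div, Finset.sum_add_distrib, ← Finset.mul_sum] at h1
    have h4 := hBessel (L z)
    have h5 := mul_le_mul_of_nonneg_left (hBessel z) (sq_nonneg γ)
    refine (abs_le_of_sq_le_sq' ?_ (by positivity)).2
    rw [mul_pow]
    linarith
  · rw [hL, inner_sum]
    refine Finset.sum_congr rfl fun i _ => ?_
    rw [inner_smul_right, inner_smul_right, ← inner_conj_symm z (W i)]
    push_cast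
    rw [← Complex.mul_conj']
    ring

theorem exists_linearMap_of_mem_convexHull {γ α : ℝ} (hγ : 0 ≤ γ) {u v : E} (hu : ‖u‖ = 1)
    (h : (⟪u, v⟫_ℂ, ‖v‖ ^ 2) ∈ convexHull ℝ (sectorParaboloid γ α)) :
    ∃ L : E →ₗ[ℂ] E, L u = v ∧ (∀ z, ‖L z‖ ≤ γ * ‖z‖) ∧
      ∀ z, 0 ≤ Real.sin α * (⟪z, L z⟫_ℂ).re + Real.cos α * (⟪z, L z⟫_ℂ).im ∧
        0 ≤ Real.sin α * (⟪z, L z⟫_ℂ).re - Real.cos α * (⟪z, L z⟫_ℂ).im := by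
  rw [convexHull_eq] at h
  obtain ⟨ι, S, w, p, hw, hw1, hp, hsum⟩ := h
  rw [Finset.centerMass_eq_of_sum_1 _ _ hw1] at hsum
  have hpl : ∀ i ∈ S, (p i).1 ∈ sectorDisk γ α ∧ (p i).2 = ‖(p i).1‖ ^ 2 := by
    intro i hi
    obtain ⟨l, hl, hlp⟩ := hp i hi
    rw [← hlp]
    exact ⟨hl, rfl⟩
  obtain ⟨hsum1, hsum2⟩ := Prod.ext_iff.1 hsum
  simp only [Prod.fst_sum, Prod.snd_sum, Prod.smul_fst, Prod.smul_snd, Complex.real_smul,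
    smul_eq_mul] at hsum1 hsum2
  obtain ⟨L, hL, hLn, hLi⟩ := exists_linearMap_of_weights S w (fun i => (p i).1) hγ hw hw1
    (fun i hi => (hpl i hi).1.1) hu hsum1
    (by rw [← hsum2]; exact Finset.sum_congr rfl fun i hi => by rw [(hpl i hi).2])
  refine ⟨L, hL, hLn, fun z => ?_⟩
  obtain ⟨r, hr, hz⟩ := hLi z
  rw [hz]
  simp only [Complex.re_sum, Complex.im_sum, Complex.re_ofReal_mul, Complex.im_ofReal_mul,
    Finset.mul_sum, ← Finset.sum_add_distrib, ← Finset.sum_sub_distrib]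
  refine ⟨Finset.sum_nonneg fun i hi => ?_, Finset.sum_nonneg fun i hi => ?_⟩
  · have := mul_nonneg (hr i hi) (hpl i hi).1.2.1
    linarith
  · have := mul_nonneg (hr i hi) (hpl i hi).1.2.2
    linarith

end Interpolation

/-- Gordan-type alternative for a convex-like family of functions on a compact set. -/
theorem exists_nonneg_combination_pos {X ι : Type*} [TopologicalSpace X] [Fintype ι] {K : Set X}
    (hK : IsCompact K) (hne : K.Nonempty) {f : X → ι → ℝ} (hf : Continuous f)
    (hconv : ∀ x ∈ K, ∀ y ∈ K, ∀ s t : ℝ, 0 ≤ s → 0 ≤ t → s + t = 1 →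
      ∃ z ∈ K, f z ≤ s • f x + t • f y)
    (hno : ∀ z ∈ K, ¬ f z ≤ 0) :
    ∃ k : ι → ℝ, (∀ i, 0 ≤ k i) ∧ ∀ z ∈ K, 0 < ∑ i, k i * f z i := by
  classical
  have hF : f '' K + Set.Ici 0 = {c | ∃ z ∈ K, f z ≤ c} := by
    ext c
    constructor
    · rintro ⟨_, ⟨z, hz, rfl⟩, e, he, rfl⟩
      exact ⟨z, hz, le_add_of_nonneg_right he⟩
    · rintro ⟨z, hz, hzc⟩
      exact ⟨f z, ⟨z, hz, rfl⟩, c - f z, sub_nonneg.2 hzc, by simp⟩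
  have hclosed : IsClosed {c | ∃ z ∈ K, f z ≤ c} :=
    hF ▸ isClosed_Ici.add_left_of_isCompact (hK.image hf)
  have hcvx : Convex ℝ {c | ∃ z ∈ K, f z ≤ c} := by
    rintro c ⟨x, hx, hxc⟩ c' ⟨y, hy, hyc⟩ s t hs ht hst
    obtain ⟨z, hz, hzle⟩ := hconv x hx y hy s t hs ht hst
    exact ⟨z, hz, hzle.trans (add_le_add (smul_le_smul_of_nonneg_left hxc hs)
      (smul_le_smul_of_nonneg_left hyc ht))⟩
  obtain ⟨g, r, hg0, hgr⟩ := geometric_hahn_banach_point_closed hcvx hclosed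
    (x := 0) (by rintro ⟨z, hz, hz0⟩; exact hno z hz hz0)
  rw [map_zero] at hg0
  refine ⟨fun i => g (Pi.single i 1), fun i => ?_, fun z hz => ?_⟩
  · by_contra! hneg
    obtain ⟨z, hz⟩ := hne
    obtain ⟨N, hN⟩ := exists_nat_gt (g (f z) / -g (Pi.single i 1))
    have h1 := hgr (f z + (N : ℝ) • Pi.single i 1)
      ⟨z, hz, le_add_of_nonneg_right (smul_nonneg N.cast_nonneg (Pi.single_nonneg.2 zero_le_one))⟩
    rw [div_lt_iff₀ (by linarith)] at hN
    rw [map_add, map_smul, smul_eq_mul] at h1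
    linarith
  · have h1 := hgr (f z) ⟨z, hz, le_rfl⟩
    rw [← Finset.univ_sum_single (f z), map_sum] at h1
    refine (hg0.trans h1).trans_eq (Finset.sum_congr rfl fun i _ => ?_)
    rw [← mul_one (f z i), ← smul_eq_mul, Pi.single_smul, map_smul, smul_eq_mul, smul_eq_mul,
      mul_one, mul_comm]

section MatrixForms

variable {n : ℕ}

theorem Hpart_isHermitian (M : Matrix (Fin n) (Fin n) ℂ) : (Hpart M).IsHermitian := by
  unfold Hpart
  rw [Matrix.IsHermitian, conjTranspose_smul, conjTranspose_add, conjTranspose_conjTranspose,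
    add_comm]
  simp

theorem star_dotProduct_mulVec_eq_inner (M : Matrix (Fin n) (Fin n) ℂ) (x : Fin n → ℂ) :
    star x ⬝ᵥ (M *ᵥ x) = ⟪WithLp.toLp 2 x, M.toEuclideanLin (WithLp.toLp 2 x)⟫_ℂ := by
  rw [toLpLin_toLp, toLin'_apply, EuclideanSpace.inner_toLp_toLp, dotProduct_comm]

theorem star_dotProduct_Hpart_mulVec (M : Matrix (Fin n) (Fin n) ℂ) (x : Fin n → ℂ) :
    star x ⬝ᵥ (Hpart M *ᵥ x) = ((star x ⬝ᵥ (M *ᵥ x)).re : ℂ) := by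
  have h : star x ⬝ᵥ (Mᴴ *ᵥ x) = conj (star x ⬝ᵥ (M *ᵥ x)) := by
    rw [starRingEnd_apply, ← star_dotProduct_star, star_star, star_mulVec,
      dotProduct_mulVec]
  rw [Hpart, smul_mulVec, add_mulVec, dotProduct_smul, dotProduct_add, h, Complex.add_conj]
  simp

theorem star_dotProduct_conjTranspose_mul_mulVec (M : Matrix (Fin n) (Fin n) ℂ) (x : Fin n → ℂ) :
    star x ⬝ᵥ ((Mᴴ * M) *ᵥ x) = ((‖M.toEuclideanLin (WithLp.toLp 2 x)‖ ^ 2 : ℝ) : ℂ) := by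
  rw [← mulVec_mulVec, dotProduct_mulVec, vecMul_conjTranspose, star_star, toLpLin_toLp,
    toLin'_apply, dotProduct_comm, ← EuclideanSpace.inner_toLp_toLp, inner_self_eq_norm_sq_to_K]
  simp

theorem star_dotProduct_self (x : Fin n → ℂ) :
    star x ⬝ᵥ x = ((‖(WithLp.toLp 2 x : EuclideanSpace ℂ (Fin n))‖ ^ 2 : ℝ) : ℂ) := by
  rw [dotProduct_comm, ← EuclideanSpace.inner_toLp_toLp, inner_self_eq_norm_sq_to_K]
  simp

theorem re_exp_neg_mul (α : ℝ) (a : ℂ) :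
    (Complex.exp (-Complex.I * ((Real.pi / 2 - α : ℝ) : ℂ)) * a).re =
      Real.sin α * a.re + Real.cos α * a.im := by
  rw [show -Complex.I * ((Real.pi / 2 - α : ℝ) : ℂ) = ((-(Real.pi / 2 - α) : ℝ) : ℂ) * Complex.I by
    push_cast; ring, Complex.mul_re, Complex.exp_ofReal_mul_I_re, Complex.exp_ofReal_mul_I_im,
    Real.cos_neg, Real.sin_neg, Real.cos_pi_div_two_sub, Real.sin_pi_div_two_sub]
  ring

theorem re_exp_mul (α : ℝ) (a : ℂ) :
    (Complex.exp (Complex.I * ((Real.pi / 2 - α : ℝ) : ℂ)) * a).re =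
      Real.sin α * a.re - Real.cos α * a.im := by
  rw [mul_comm Complex.I, Complex.mul_re, Complex.exp_ofReal_mul_I_re,
    Complex.exp_ofReal_mul_I_im, Real.cos_pi_div_two_sub, Real.sin_pi_div_two_sub]

theorem Hpart_smul_posSemidef {e : ℂ} {M : Matrix (Fin n) (Fin n) ℂ}
    (h : ∀ z, 0 ≤ (e * ⟪z, M.toEuclideanLin z⟫_ℂ).re) : (Hpart (e • M)).PosSemidef := by
  refine .of_dotProduct_mulVec_nonneg (Hpart_isHermitian _) fun x => ?_
  rw [star_dotProduct_Hpart_mulVec, smul_mulVec, dotProduct_smul, star_dotProduct_mulVec_eq_inner,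
    smul_eq_mul]
  exact_mod_cast h _

theorem memSD_of_toEuclideanLin {γ α : ℝ} {B : Matrix (Fin n) (Fin n) ℂ}
    (hn : ∀ z, ‖B.toEuclideanLin z‖ ≤ γ * ‖z‖)
    (hs : ∀ z, 0 ≤ Real.sin α * (⟪z, B.toEuclideanLin z⟫_ℂ).re
        + Real.cos α * (⟪z, B.toEuclideanLin z⟫_ℂ).im ∧
      0 ≤ Real.sin α * (⟪z, B.toEuclideanLin z⟫_ℂ).re
        - Real.cos α * (⟪z, B.toEuclideanLin z⟫_ℂ).im) :
    memSD γ α B := by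
  refine ⟨.of_dotProduct_mulVec_nonneg ?_ fun x => ?_,
    Hpart_smul_posSemidef fun z => by rw [re_exp_neg_mul]; exact (hs z).1,
    Hpart_smul_posSemidef fun z => by rw [re_exp_mul]; exact (hs z).2⟩
  · refine IsHermitian.sub ?_ (isHermitian_conjTranspose_mul_self B)
    simp [Matrix.IsHermitian, conjTranspose_smul]
  · rw [sub_mulVec, dotProduct_sub, smul_mulVec, one_mulVec, dotProduct_smul,
      star_dotProduct_self, star_dotProduct_conjTranspose_mul_mulVec, smul_eq_mul,
      ← Complex.ofReal_mul, ← Complex.ofReal_sub, Complex.zero_le_real, sub_nonneg, ← mul_pow]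
    gcongr
    exact hn _

/-- A unit vector violating all four scalar inequalities yields a singular `1 + A * B` with `B` in
the sectored-disk set. -/
theorem exists_memSD_det_eq_zero {γ α : ℝ} (hγ : 0 < γ) (hc : 0 < Real.cos α)
    (hsin : 0 ≤ Real.sin α) (A : Matrix (Fin n) (Fin n) ℂ) {x : EuclideanSpace ℂ (Fin n)}
    (hx : ‖x‖ = 1) (h₁ : 1 - γ ^ 2 * ‖A.toEuclideanLin x‖ ^ 2 ≤ 0)
    (h₂ : Real.sin α * (⟪x, A.toEuclideanLin x⟫_ℂ).re
      + Real.cos α * (⟪x, A.toEuclideanLin x⟫_ℂ).im ≤ 0)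
    (h₃ : Real.sin α * (⟪x, A.toEuclideanLin x⟫_ℂ).re
      - Real.cos α * (⟪x, A.toEuclideanLin x⟫_ℂ).im ≤ 0)
    (h₄ : γ / Real.cos α * (⟪x, A.toEuclideanLin x⟫_ℂ).re + 1 ≤ 0) :
    ∃ B : Matrix (Fin n) (Fin n) ℂ, memSD γ α B ∧ (1 + A * B).det = 0 := by
  set y := A.toEuclideanLin x with hy
  set a := ⟪x, y⟫_ℂ with ha
  have hy0 : y ≠ 0 := by
    intro h0
    rw [h0] at h₁
    norm_num at h₁
  set s := ‖y‖ with hs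
  have hs0 : 0 < s := norm_pos_iff.2 hy0
  set u : EuclideanSpace ℂ (Fin n) := ((s⁻¹ : ℝ) : ℂ) • y with hu
  set v : EuclideanSpace ℂ (Fin n) := ((-s⁻¹ : ℝ) : ℂ) • x with hv
  have hun : ‖u‖ = 1 := by
    rw [hu, norm_smul, Complex.norm_real, Real.norm_of_nonneg (by positivity), ← hs]
    field_simp
  have hvn : ‖v‖ ^ 2 = (s ^ 2)⁻¹ := by
    rw [hv, norm_smul, Complex.norm_real, hx, mul_one, norm_neg, Real.norm_of_nonneg (by positivity),
      inv_pow]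
  have hb : ⟪u, v⟫_ℂ = ((-(s ^ 2)⁻¹ : ℝ) : ℂ) * conj a := by
    rw [hu, hv, inner_smul_left, inner_smul_right, ha, inner_conj_symm, Complex.conj_ofReal]
    push_cast
    field_simp
  have hre : (⟪u, v⟫_ℂ).re = -(s ^ 2)⁻¹ * a.re := by
    rw [hb, Complex.re_ofReal_mul, Complex.conj_re]
  have him : (⟪u, v⟫_ℂ).im = (s ^ 2)⁻¹ * a.im := by
    rw [hb, Complex.im_ofReal_mul, Complex.conj_im]
    ring
  have hs2 : 0 < (s ^ 2)⁻¹ := by positivity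
  have hmem : (⟪u, v⟫_ℂ, ‖v‖ ^ 2) ∈ convexHull ℝ (sectorParaboloid γ α) := by
    refine mk_mem_convexHull_sectorParaboloid hγ hc hsin ?_ ?_ ?_ ?_ ?_
    · rw [hre, him]
      nlinarith
    · rw [hre, him]
      nlinarith
    · have := norm_inner_le_norm (𝕜 := ℂ) u v
      rw [hun, one_mul] at this
      gcongr
    · rw [hvn, inv_le_iff_one_le_mul₀ (by positivity)]
      linarith
    · rw [hvn, hre]
      have h5 : γ * a.re ≤ -Real.cos α := by
        have : γ / Real.cos α * a.re = γ * a.re / Real.cos α := by ring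
        rw [this, ← le_neg_iff_add_nonpos_right, div_le_iff₀ hc] at h₄
        linarith
      nlinarith
  obtain ⟨L, hLu, hLn, hLs⟩ := exists_linearMap_of_mem_convexHull hγ.le hun hmem
  obtain ⟨B, rfl⟩ := (toEuclideanLin (𝕜 := ℂ) (m := Fin n) (n := Fin n)).surjective L
  refine ⟨B, memSD_of_toEuclideanLin hLn hLs, ?_⟩
  have hBy : B.toEuclideanLin y = -x := by
    have h6 : ((s : ℝ) : ℂ) ≠ 0 := by exact_mod_cast hs0.ne'
    have h7 : y = (s : ℂ) • u := by
      rw [hu, smul_smul]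
      push_cast
      rw [mul_inv_cancel₀ h6, one_smul]
    rw [h7, map_smul, hLu, hv, smul_smul]
    push_cast
    rw [mul_neg, mul_inv_cancel₀ h6, neg_one_smul]
  rw [← exists_mulVec_eq_zero_iff]
  refine ⟨y.ofLp, by simpa using hy0, ?_⟩
  have hB' : B *ᵥ y.ofLp = -x.ofLp := by
    have := congrArg WithLp.ofLp hBy
    simpa [toLpLin_apply] using this
  have hA' : A *ᵥ x.ofLp = y.ofLp := by
    rw [hy]
    simp [toLpLin_apply]
  rw [add_mulVec, one_mulVec, ← mulVec_mulVec, hB', mulVec_neg, hA', add_neg_cancel]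

end MatrixForms

/-- Necessary condition for the matrix sectored-disk problem: if `det(I + A·B) ≠ 0` for
all `B ∈ S_γ(α)`, then the LMI with the `γ·sec(α)` term is feasible. -/
theorem sectored_disk_necessary {n : ℕ} (hn : 3 ≤ n) (γ α : ℝ) (hγ : 0 < γ)
    (hα : α ∈ Set.Ico (0 : ℝ) (Real.pi / 2))
    (A : Matrix (Fin n) (Fin n) ℂ) (hA : IsUnit A.det)
    (h : ∀ B : Matrix (Fin n) (Fin n) ℂ, memSD γ α B → (1 + A * B).det ≠ 0) :
    ∃ k₁ k₂ k₃ k₄ : ℝ, 0 ≤ k₁ ∧ 0 ≤ k₂ ∧ 0 ≤ k₃ ∧ 0 ≤ k₄ ∧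
      (k₁ • ((1 : Matrix (Fin n) (Fin n) ℂ) - ((γ ^ 2 : ℝ) : ℂ) • (Aᴴ * A))
        + k₂ • Hpart (Complex.exp (-Complex.I * ((Real.pi / 2 - α : ℝ) : ℂ)) • A)
        + k₃ • Hpart (Complex.exp (Complex.I * ((Real.pi / 2 - α : ℝ) : ℂ)) • A)
        + k₄ • ((((γ / Real.cos α : ℝ) : ℂ) • Hpart A) + 1)).PosDef := by
  have hc : 0 < Real.cos α := Real.cos_pos_of_mem_Ioo ⟨by linarith [hα.1, Real.pi_pos], hα.2⟩
  have hsin : 0 ≤ Real.sin α :=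
    Real.sin_nonneg_of_nonneg_of_le_pi hα.1 (by linarith [hα.2, Real.pi_pos])
  have : Nonempty (Fin n) := ⟨⟨0, by omega⟩⟩
  set T := A.toEuclideanLin
  have hTc : Continuous T := T.continuous_of_finiteDimensional
  let f : EuclideanSpace ℂ (Fin n) → Fin 4 → ℝ := fun z =>
    ![1 - γ ^ 2 * ‖T z‖ ^ 2,
      Real.sin α * (⟪z, T z⟫_ℂ).re + Real.cos α * (⟪z, T z⟫_ℂ).im,
      Real.sin α * (⟪z, T z⟫_ℂ).re - Real.cos α * (⟪z, T z⟫_ℂ).im,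
      γ / Real.cos α * (⟪z, T z⟫_ℂ).re + 1]
  have hf : Continuous f := by
    refine continuous_pi fun i => ?_
    fin_cases i <;> simp [f] <;> fun_prop
  have hconv : ∀ x ∈ Metric.sphere (0 : EuclideanSpace ℂ (Fin n)) 1, ∀ y ∈ Metric.sphere 0 1,
      ∀ s t : ℝ, 0 ≤ s → 0 ≤ t → s + t = 1 →
        ∃ z ∈ Metric.sphere 0 1, f z ≤ s • f x + t • f y := by
    intro x hx y hy s t hs ht hst
    rw [mem_sphere_zero_iff_norm] at hx hy
    obtain ⟨z, hz, hza, hzp⟩ := exists_unit_inner_eq_norm_ge T hx hy hs ht hst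
    refine ⟨z, mem_sphere_zero_iff_norm.2 hz, fun i => ?_⟩
    have hre := congrArg Complex.re hza
    have him := congrArg Complex.im hza
    simp only [Complex.add_re, Complex.add_im, Complex.re_ofReal_mul, Complex.im_ofReal_mul]
      at hre him
    fin_cases i
    · simp [f]
      nlinarith [mul_le_mul_of_nonneg_left hzp (sq_nonneg γ)]
    · simp [f, hre, him]
      linarith
    · simp [f, hre, him]
      linarith
    · simp [f, hre]
      linarith
  have hno : ∀ z ∈ Metric.sphere (0 : EuclideanSpace ℂ (Fin n)) 1, ¬ f z ≤ 0 := by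
    intro z hz hle
    obtain ⟨B, hB, hdet⟩ := exists_memSD_det_eq_zero hγ hc hsin A (mem_sphere_zero_iff_norm.1 hz)
      (hle 0) (hle 1) (hle 2) (hle 3)
    exact h B hB hdet
  obtain ⟨k, hk, hpos⟩ := exists_nonneg_combination_pos
    (isCompact_sphere (0 : EuclideanSpace ℂ (Fin n)) 1) (NormedSpace.sphere_nonempty.2 zero_le_one)
    hf hconv hno
  refine ⟨k 0, k 1, k 2, k 3, hk 0, hk 1, hk 2, hk 3, .of_dotProduct_mulVec_pos ?_ ?_⟩
  · refine (((IsHermitian.smul ?_ (.all _)).add ((Hpart_isHermitian _).smul (.all _))).add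
      ((Hpart_isHermitian _).smul (.all _))).add (IsHermitian.smul ?_ (.all _))
    · exact isHermitian_one.sub ((isHermitian_conjTranspose_mul_self A).smul
        (Complex.conj_ofReal _))
    · exact ((Hpart_isHermitian A).smul (Complex.conj_ofReal _)).add isHermitian_one
  · intro x hx
    set X : EuclideanSpace ℂ (Fin n) := WithLp.toLp 2 x with hX
    have hX0 : X ≠ 0 := by simpa [hX] using hx
    have hXn : 0 < ‖X‖ := norm_pos_iff.2 hX0
    have hunit := hpos (((‖X‖⁻¹ : ℝ) : ℂ) • X) (by simp [norm_smul, hXn.ne'])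
    simp only [Fin.sum_univ_four, f, map_smul, inner_smul_left, inner_smul_right, norm_smul,
      Complex.conj_ofReal, Complex.re_ofReal_mul, Complex.im_ofReal_mul, Complex.norm_real,
      Matrix.cons_val, norm_inv, norm_norm] at hunit
    have hform : star x ⬝ᵥ ((k 0 • ((1 : Matrix (Fin n) (Fin n) ℂ)
          - ((γ ^ 2 : ℝ) : ℂ) • (Aᴴ * A))
        + k 1 • Hpart (Complex.exp (-Complex.I * ((Real.pi / 2 - α : ℝ) : ℂ)) • A)
        + k 2 • Hpart (Complex.exp (Complex.I * ((Real.pi / 2 - α : ℝ) : ℂ)) • A)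
        + k 3 • ((((γ / Real.cos α : ℝ) : ℂ) • Hpart A) + 1)) *ᵥ x) =
        ((k 0 * (‖X‖ ^ 2 - γ ^ 2 * ‖T X‖ ^ 2)
          + k 1 * (Real.sin α * (⟪X, T X⟫_ℂ).re + Real.cos α * (⟪X, T X⟫_ℂ).im)
          + k 2 * (Real.sin α * (⟪X, T X⟫_ℂ).re - Real.cos α * (⟪X, T X⟫_ℂ).im)
          + k 3 * (γ / Real.cos α * (⟪X, T X⟫_ℂ).re + ‖X‖ ^ 2) : ℝ) : ℂ) := by
      simp only [add_mulVec, sub_mulVec, smul_mulVec, one_mulVec, dotProduct_add,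
        dotProduct_sub, dotProduct_smul, star_dotProduct_Hpart_mulVec, star_dotProduct_self,
        star_dotProduct_conjTranspose_mul_mulVec, smul_eq_mul, Complex.real_smul,
        re_exp_neg_mul, re_exp_mul]
      simp only [star_dotProduct_mulVec_eq_inner]
      push_cast
      rfl
    rw [hform, Complex.zero_lt_real]
    have h2 := mul_pos (pow_pos hXn 2) hunit
    refine h2.trans_eq ?_
    field_simp
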